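/- Assume only q ≠ 0. The ordered monomials span U_q^+(A_N): every element of U_q^+(A_N) is a K-linear combination of the elements m_α, where α ranges over the finitely supported functions Λ_N → ℕ. Equivalently, the images of the <_lex-nondecreasing words in the generators, together with 1, span U_q^+(A_N) over K. -/

import Mathlib

/-- The index set Λ_N = {(i,j) : 1 ≤ i < j ≤ N+1}. -/
def Lam (N : ℕ) : Type := {p : ℕ × ℕ // 1 ≤ p.1 ∧ p.1 < p.2 ∧ p.2 ≤ N + 1}

/-- Lexicographic linear order on Λ_N: (l,k) < (i,j) iff l < i, or l = i and k < j. -/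
instance (N : ℕ) : LinearOrder (Lam N) :=
  LinearOrder.lift' (fun p => toLex p.val) (fun a b h => Subtype.ext (toLex.injective h))

/-- The Jimbo relations defining U_q^+(A_N): here `a = (i,j)` and `b = (m,n)`. -/
inductive JimboRel (K : Type) [Field K] (q : K) (N : ℕ) :
    FreeAlgebra K (Lam N) → FreeAlgebra K (Lam N) → Prop
  /-- C1 : i = m < j < n -/
  | c1 : ∀ a b : Lam N, a.1.1 = b.1.1 → a.1.2 < b.1.2 →
      JimboRel K q N (FreeAlgebra.ι K b * FreeAlgebra.ι K a)
        ((q ^ 2)⁻¹ • (FreeAlgebra.ι K a * FreeAlgebra.ι K b))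
  /-- C3 : i < m < j = n -/
  | c3 : ∀ a b : Lam N, a.1.1 < b.1.1 → a.1.2 = b.1.2 →
      JimboRel K q N (FreeAlgebra.ι K b * FreeAlgebra.ι K a)
        ((q ^ 2)⁻¹ • (FreeAlgebra.ι K a * FreeAlgebra.ι K b))
  /-- C2 : i < m < n < j -/
  | c2 : ∀ a b : Lam N, a.1.1 < b.1.1 → b.1.2 < a.1.2 →
      JimboRel K q N (FreeAlgebra.ι K b * FreeAlgebra.ι K a)
        (FreeAlgebra.ι K a * FreeAlgebra.ι K b)
  /-- C6 : i < j < m < n -/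
  | c6 : ∀ a b : Lam N, a.1.2 < b.1.1 →
      JimboRel K q N (FreeAlgebra.ι K b * FreeAlgebra.ι K a)
        (FreeAlgebra.ι K a * FreeAlgebra.ι K b)
  /-- C4 : i < m < j < n, with c = (i,n) and d = (m,j) -/
  | c4 : ∀ a b c d : Lam N, a.1.1 < b.1.1 → b.1.1 < a.1.2 → a.1.2 < b.1.2 →
      c.1 = (a.1.1, b.1.2) → d.1 = (b.1.1, a.1.2) →
      JimboRel K q N (FreeAlgebra.ι K b * FreeAlgebra.ι K a)
        (FreeAlgebra.ι K a * FreeAlgebra.ι K b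
          - (q ^ 2 - (q ^ 2)⁻¹) • (FreeAlgebra.ι K c * FreeAlgebra.ι K d))
  /-- C5 : i < j = m < n, with c = (i,n) -/
  | c5 : ∀ a b c : Lam N, a.1.2 = b.1.1 → c.1 = (a.1.1, b.1.2) →
      JimboRel K q N (FreeAlgebra.ι K b * FreeAlgebra.ι K a)
        ((q ^ 2) • (FreeAlgebra.ι K a * FreeAlgebra.ι K b) - q • FreeAlgebra.ι K c)

/-- U_q^+(A_N): the free algebra on the X_{ij} modulo the Jimbo relations. -/
abbrev UqPlus (K : Type) [Field K] (q : K) (N : ℕ) := RingQuot (JimboRel K q N)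

/-- x_{ij}: the image of the generator X_{ij} in U_q^+(A_N). -/
noncomputable def xg (K : Type) [Field K] (q : K) (N : ℕ) (p : Lam N) : UqPlus K q N :=
  RingQuot.mkAlgHom K (JimboRel K q N) (FreeAlgebra.ι K p)

/-- The ordered monomial m_α = ∏ x_{ij}^{α(i,j)}, the product taken in <_lex-increasing order. -/
noncomputable def mon (K : Type) [Field K] (q : K) (N : ℕ) (α : Lam N →₀ ℕ) : UqPlus K q N :=
  ((α.support.sort (· ≤ ·)).map (fun p => xg K q N p ^ α p)).prod

/-- A monomial order on the finitely supported functions σ → ℕ: a well-founded strict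
total order for which 0 is minimal and which is translation invariant. -/
def IsMonomialOrder (σ : Type) (r : (σ →₀ ℕ) → (σ →₀ ℕ) → Prop) : Prop :=
  WellFounded r ∧ (∀ α, ¬ r α α) ∧ (∀ α β γ, r α β → r β γ → r α γ) ∧
  (∀ α β, α ≠ β → r α β ∨ r β α) ∧ (∀ α, α ≠ 0 → r 0 α) ∧
  (∀ α β γ, r α β → r (α + γ) (β + γ))

section

variable {K : Type} [Field K] {q : K} {N : ℕ}

theorem Lam.lt_iff (a b : Lam N) :
    a < b ↔ a.1.1 < b.1.1 ∨ a.1.1 = b.1.1 ∧ a.1.2 < b.1.2 :=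
  Prod.Lex.toLex_lt_toLex

theorem Lam.wellFounded_lt : WellFounded ((· < ·) : Lam N → Lam N → Prop) :=
  InvImage.wf (fun p : Lam N => toLex p.1) _root_.wellFounded_lt

/-- A descent `x_b x_a` with `a < b` is a combination of words which are either shorter or of
the same length with a smaller first letter. -/
theorem xg_mul_xg_mem_span {a b : Lam N} (hab : a < b) :
    xg K q N b * xg K q N a ∈ Submodule.span K ((fun w : List (Lam N) => (w.map (xg K q N)).prod) ''
      {w | w.length < 2 ∨ ∃ c d, w = [c, d] ∧ c < b}) := by
  have hpair : ∀ c d : Lam N, c < b → xg K q N c * xg K q N d ∈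
      Submodule.span K ((fun w : List (Lam N) => (w.map (xg K q N)).prod) ''
        {w | w.length < 2 ∨ ∃ c d, w = [c, d] ∧ c < b}) := fun c d hc =>
    Submodule.subset_span ⟨[c, d], Or.inr ⟨c, d, rfl, hc⟩, by simp⟩
  have hsingle : ∀ c : Lam N, xg K q N c ∈
      Submodule.span K ((fun w : List (Lam N) => (w.map (xg K q N)).prod) ''
        {w | w.length < 2 ∨ ∃ c d, w = [c, d] ∧ c < b}) := fun c =>
    Submodule.subset_span ⟨[c], Or.inl (by simp), by simp⟩
  have hrel : ∀ {y}, JimboRel K q N (FreeAlgebra.ι K b * FreeAlgebra.ι K a) y →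
      xg K q N b * xg K q N a = RingQuot.mkAlgHom K (JimboRel K q N) y := fun h => by
    rw [xg, xg, ← map_mul]
    exact RingQuot.mkAlgHom_rel K h
  obtain ⟨ha1, ha2, ha3⟩ := a.2
  obtain ⟨hb1, hb2, hb3⟩ := b.2
  rcases (Lam.lt_iff a b).1 hab with h | ⟨h, h'⟩
  · rcases lt_trichotomy a.1.2 b.1.1 with hjm | hjm | hjm
    · rw [hrel (.c6 a b hjm), map_mul]
      exact hpair _ _ hab
    · let c : Lam N := ⟨(a.1.1, b.1.2), by dsimp only; omega⟩
      rw [hrel (.c5 a b c hjm rfl), map_sub, map_smul, map_smul, map_mul]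
      exact sub_mem (Submodule.smul_mem _ _ (hpair _ _ hab)) (Submodule.smul_mem _ _ (hsingle _))
    · rcases lt_trichotomy a.1.2 b.1.2 with hjn | hjn | hjn
      · let c : Lam N := ⟨(a.1.1, b.1.2), by dsimp only; omega⟩
        let d : Lam N := ⟨(b.1.1, a.1.2), by dsimp only; omega⟩
        rw [hrel (.c4 a b c d h hjm hjn rfl rfl), map_sub, map_smul, map_mul, map_mul]
        exact sub_mem (hpair _ _ hab)
          (Submodule.smul_mem _ _ (hpair _ _ ((Lam.lt_iff c b).2 (Or.inl h))))
      · rw [hrel (.c3 a b h hjn), map_smul, map_mul]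
        exact Submodule.smul_mem _ _ (hpair _ _ hab)
      · rw [hrel (.c2 a b h hjn), map_mul]
        exact hpair _ _ hab
  · rw [hrel (.c1 a b h h'), map_smul, map_mul]
    exact Submodule.smul_mem _ _ (hpair _ _ hab)

/-- A nondecreasing word is the concatenation of the powers of its letters. -/
theorem flatMap_sort_replicate_count {α : Type*} [LinearOrder α] {w : List α}
    (hw : w.Pairwise (· ≤ ·)) :
    (w.toFinset.sort (· ≤ ·)).flatMap (fun p => List.replicate (w.count p) p) = w := by
  refine List.Perm.eq_of_pairwise' (r := (· ≤ ·)) ?_ hw ?_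
  · rw [List.pairwise_flatMap]
    refine ⟨fun a _ => List.pairwise_replicate.2 (Or.inr le_rfl),
      (Finset.pairwise_sort _ _).imp fun h x hx y hy => ?_⟩
    rwa [List.eq_of_mem_replicate hx, List.eq_of_mem_replicate hy]
  · rw [List.perm_iff_count]
    intro p
    rw [List.count_flatMap, ← List.sum_toFinset _ (Finset.sort_nodup _ _), Finset.sort_toFinset]
    simpa [List.count_replicate] using fun h => (List.count_eq_zero.2 h).symm

theorem prod_map_xg_of_pairwise {w : List (Lam N)} (hw : w.Pairwise (· ≤ ·)) :
    (w.map (xg K q N)).prod = mon K q N (Multiset.toFinsupp (w : Multiset (Lam N))) := by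
  conv_lhs => rw [← flatMap_sort_replicate_count hw]
  simp [mon, List.flatMap, List.prod_flatten, Function.comp_def]

theorem prod_map_xg_mem_span (w : List (Lam N)) :
    (w.map (xg K q N)).prod ∈ Submodule.span K (Set.range (mon K q N)) := by
  induction w using (List.Shortlex.wf Lam.wellFounded_lt).induction with
  | _ w ih =>
    by_cases hw : w.IsChain (· ≤ ·)
    · rw [prod_map_xg_of_pairwise hw.pairwise]
      exact Submodule.subset_span ⟨_, rfl⟩
    · rw [List.isChain_iff_forall_rel_of_append_cons_cons] at hw
      push Not at hw
      obtain ⟨b, a, u, v, rfl, hab⟩ := hw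
      let f : UqPlus K q N →ₗ[K] UqPlus K q N :=
        LinearMap.mulLeft K (u.map (xg K q N)).prod ∘ₗ LinearMap.mulRight K (v.map (xg K q N)).prod
      have hle : Submodule.span K ((fun w : List (Lam N) => (w.map (xg K q N)).prod) ''
          {w | w.length < 2 ∨ ∃ c d, w = [c, d] ∧ c < b}) ≤
          (Submodule.span K (Set.range (mon K q N))).comap f := by
        rw [Submodule.span_le]
        rintro _ ⟨w, hw, rfl⟩
        have key := ih (u ++ (w ++ v)) (by
          rcases hw with hw | ⟨c, d, rfl, hc⟩
          · exact .of_length_lt (by simp; omega)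
          · exact .of_lex (by simp) (.append_left _ (.rel hc) _))
        simpa [f] using key
      simpa [f, mul_assoc] using hle (xg_mul_xg_mem_span hab)

theorem adjoin_range_xg : Algebra.adjoin K (Set.range (xg K q N)) = ⊤ := by
  have h : Set.range (xg K q N) =
      RingQuot.mkAlgHom K (JimboRel K q N) '' Set.range (FreeAlgebra.ι K) := by
    rw [← Set.range_comp]
    rfl
  rw [h, ← AlgHom.map_adjoin, FreeAlgebra.adjoin_range_ι, Algebra.map_top, AlgHom.range_eq_top]
  exact RingQuot.mkAlgHom_surjective K _

end

/-- Assuming only q ≠ 0, the ordered monomials m_α span U_q^+(A_N) over K. -/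
theorem uqPlus_monomials_span (K : Type) [Field K] (q : K) (hq0 : q ≠ 0)
    (N : ℕ) (hN : 1 ≤ N) :
    Submodule.span K (Set.range (mon K q N)) = ⊤ := by
  rw [eq_top_iff, ← Algebra.top_toSubmodule, ← adjoin_range_xg, Algebra.adjoin_eq_span,
    Submodule.span_le]
  intro x hx
  obtain ⟨l, hl, rfl⟩ := Submonoid.exists_list_of_mem_closure hx
  obtain ⟨w, rfl⟩ : l ∈ Set.range (List.map (xg K q N)) := by rwa [Set.range_list_map]
  exact prod_map_xg_mem_span w
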